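/- arXiv:0706.0570 — 2 statements merged into one kernel-verified Lean document; each statement's English description precedes it below -/
import Mathlib

section
/- Let L be a bounded distributive lattice and n ≥ 1, and let p : L^n → L be a weighted lattice polynomial function. Then for all x ∈ L^n, p(x) = ⋀_{S ⊆ [n]} ( β_p(S) ∨ ⋁_{i ∈ S} x_i ), where β_p(S) := p(e_{[n]∖S}); i.e., p = p^∧_{β_p}. -/
/-- Weighted lattice polynomial (w.l.p.) functions from `L^n` to `L`: the smallest
class containing all coordinate projections and all constant functions, and closed
under pointwise `⊓` and `⊔`. -/
inductive IsWLP {L : Type*} [Lattice L] {n : ℕ} : ((Fin n → L) → L) → Prop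
  | proj (k : Fin n) : IsWLP (fun x => x k)
  | const (c : L) : IsWLP (fun _ => c)
  | inf {p q : (Fin n → L) → L} : IsWLP p → IsWLP q → IsWLP (fun x => p x ⊓ q x)
  | sup {p q : (Fin n → L) → L} : IsWLP p → IsWLP q → IsWLP (fun x => p x ⊔ q x)

/-- The characteristic vector `e_S` of `S ⊆ [n]`: its `i`-th component is `1` (top)
if `i ∈ S` and `0` (bottom) otherwise. -/
def charVec (L : Type*) [Lattice L] [BoundedOrder L] {n : ℕ} (S : Finset (Fin n)) :
    Fin n → L :=
  fun i => if i ∈ S then ⊤ else ⊥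

theorem charVec_mono {L : Type*} [Lattice L] [BoundedOrder L] {n : ℕ} :
    Monotone (charVec L : Finset (Fin n) → Fin n → L) := by
  intro S T h i
  by_cases hi : i ∈ S
  · simp [charVec, hi, h hi]
  · simp [charVec, hi]

namespace IsWLP

theorem monotone {L : Type*} [Lattice L] {n : ℕ} {p : (Fin n → L) → L} (hp : IsWLP p) :
    Monotone p := by
  induction hp with
  | proj k => exact fun _ _ h => h k
  | const c => exact monotone_const
  | inf _ _ hp hq => exact hp.inf hq
  | sup _ _ hp hq => exact hp.sup hq

variable {L : Type*} [DistribLattice L] [BoundedOrder L] {n : ℕ} {p : (Fin n → L) → L}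

theorem le_apply_charVec_sup (hp : IsWLP p) (S : Finset (Fin n)) (x : Fin n → L) :
    p x ≤ p (charVec L (Finset.univ \ S)) ⊔ S.sup x := by
  induction hp with
  | proj k =>
    by_cases hk : k ∈ S
    · exact le_sup_of_le_right (Finset.le_sup hk)
    · simp [charVec, hk]
  | const c => exact le_sup_left
  | inf _ _ hp hq =>
    rw [sup_inf_right]
    exact inf_le_inf hp hq
  | sup _ _ hp hq =>
    rw [sup_sup_distrib_right]
    exact sup_le_sup hp hq

theorem inf_apply_charVec_sup_le (hp : IsWLP p) (x : Fin n → L) :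
    Finset.univ.inf
      (fun S : Finset (Fin n) => p (charVec L (Finset.univ \ S)) ⊔ S.sup x) ≤ p x := by
  induction hp with
  | proj k =>
    refine (Finset.inf_le (Finset.mem_univ {k})).trans ?_
    simp [charVec]
  | const c =>
    refine (Finset.inf_le (Finset.mem_univ ∅)).trans ?_
    simp
  | inf _ _ hp hq =>
    refine le_inf (le_trans ?_ hp) (le_trans ?_ hq)
    · exact Finset.inf_mono_fun fun S _ => sup_le_sup_right inf_le_left _
    · exact Finset.inf_mono_fun fun S _ => sup_le_sup_right inf_le_right _
  | sup p_wlp q_wlp hp hq =>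
    refine le_trans ?_ (sup_le_sup hp hq)
    rw [Finset.inf_sup_inf]
    refine Finset.le_inf fun ST _ => (Finset.inf_le (Finset.mem_univ (ST.1 ∪ ST.2))).trans ?_
    rw [Finset.sup_union, sup_sup_sup_comm]
    gcongr
    · exact p_wlp.monotone
        (charVec_mono (Finset.sdiff_subset_sdiff subset_rfl Finset.subset_union_left))
    · exact q_wlp.monotone
        (charVec_mono (Finset.sdiff_subset_sdiff subset_rfl Finset.subset_union_right))

end IsWLP

/-- Lemma (second part): any w.l.p. function `p` equals `p^∧_{β_p}`, where
`β_p S := p (e_{[n] \ S})`. -/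
theorem wlp_eq_conjunctive_form_of_beta_p
    {L : Type*} [DistribLattice L] [BoundedOrder L] {n : ℕ} (hn : 1 ≤ n)
    (p : (Fin n → L) → L) (hp : IsWLP p) (x : Fin n → L) :
    p x = Finset.univ.inf
      (fun S : Finset (Fin n) => p (charVec L (Finset.univ \ S)) ⊔ S.sup x) :=
  le_antisymm (Finset.le_inf fun S _ => hp.le_apply_charVec_sup S x)
    (hp.inf_apply_charVec_sup_le x)
end

section
/- Let L be a bounded distributive lattice, n ≥ 1, and f : L^n → L. Then f satisfies the median based decomposition formula — i.e., for every k ∈ [n] and every x ∈ L^n, f(x) = median( f_k^0(x), x_k, f_k^1(x) ), where f_k^0(x) := f(x_1, …, x_{k−1}, 0, x_{k+1}, …, x_n), f_k^1(x) := f(x_1, …, x_{k−1}, 1, x_{k+1}, …, x_n), and median(a, b, c) = (a ∧ b) ∨ (b ∧ c) ∨ (a ∧ c) — if and only if f is a weighted lattice polynomial function. -/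
theorem IsWLP.monotone_s18 {L : Type*} [Lattice L] {n : ℕ} {f : (Fin n → L) → L}
    (hf : IsWLP f) : Monotone f := by
  induction hf with
  | proj k => exact fun x y h => h k
  | const c => exact monotone_const
  | inf _ _ hp hq => exact hp.inf hq
  | sup _ _ hp hq => exact hp.sup hq

/-- For `a ≤ c`, the median of `a`, `b`, `c` is `a ⊔ b ⊓ c`. -/
theorem median_eq_of_le {L : Type*} [Lattice L] {a c : L} (b : L) (h : a ≤ c) :
    (a ⊓ b) ⊔ (b ⊓ c) ⊔ (a ⊓ c) = a ⊔ b ⊓ c := by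
  rw [inf_eq_left.2 h, sup_right_comm, sup_comm (a ⊓ b) a, sup_inf_self]

theorem sup_inf_inf_sup_inf_of_le {L : Type*} [DistribLattice L] {a c a' c' : L} (b : L)
    (h : a ≤ c) (h' : a' ≤ c') :
    (a ⊔ b ⊓ c) ⊓ (a' ⊔ b ⊓ c') = (a ⊓ a') ⊔ b ⊓ (c ⊓ c') := by
  apply le_antisymm
  · rw [inf_sup_left, inf_sup_right, inf_sup_right]
    refine sup_le (sup_le le_sup_left ?_) (sup_le ?_ ?_) <;> apply le_sup_of_le_right
    · exact le_inf (inf_le_left.trans inf_le_left)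
        (inf_le_inf inf_le_right h')
    · exact le_inf (inf_le_right.trans inf_le_left)
        (inf_le_inf h inf_le_right)
    · exact le_inf (inf_le_left.trans inf_le_left)
        (inf_le_inf inf_le_right inf_le_right)
  · exact sup_le (inf_le_inf le_sup_left le_sup_left)
      (le_inf (le_sup_of_le_right (inf_le_inf_left b inf_le_left))
        (le_sup_of_le_right (inf_le_inf_left b inf_le_right)))

theorem IsWLP.eq_sup_inf_update {L : Type*} [DistribLattice L] [BoundedOrder L] {n : ℕ}
    {f : (Fin n → L) → L} (hf : IsWLP f) (k : Fin n) (x : Fin n → L) :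
    f x = f (Function.update x k ⊥) ⊔ x k ⊓ f (Function.update x k ⊤) := by
  have hle : Function.update x k ⊥ ≤ Function.update x k ⊤ := Function.update_mono bot_le
  induction hf with
  | proj j =>
    rcases eq_or_ne j k with rfl | hj
    · simp
    · simp [Function.update_of_ne hj]
  | const c => simp
  | inf hp hq ihp ihq =>
    beta_reduce
    rw [ihp, ihq]
    exact sup_inf_inf_sup_inf_of_le _ (hp.monotone_s18 hle) (hq.monotone_s18 hle)
  | sup hp hq ihp ihq =>
    beta_reduce
    rw [ihp, ihq, inf_sup_left, sup_sup_sup_comm]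

/-- If `f` satisfies the median decomposition, then freezing the variables outside `s`
yields a weighted lattice polynomial function. -/
theorem isWLP_piecewise_of_median {L : Type*} [Lattice L] [BoundedOrder L] {n : ℕ}
    {f : (Fin n → L) → L}
    (hf : ∀ (k : Fin n) (x : Fin n → L),
        f x = (f (Function.update x k ⊥) ⊓ x k) ⊔
              (x k ⊓ f (Function.update x k ⊤)) ⊔
              (f (Function.update x k ⊥) ⊓ f (Function.update x k ⊤)))
    (s : Finset (Fin n)) (y : Fin n → L) : IsWLP (fun x => f (s.piecewise x y)) := by
  induction s using Finset.induction_on generalizing y with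
  | empty => simpa using IsWLP.const (f y)
  | insert k s hk ih =>
    have h₀ := ih (Function.update y k ⊥)
    have h₁ := ih (Function.update y k ⊤)
    convert ((h₀.inf (.proj k)).sup ((IsWLP.proj k).inf h₁)).sup (h₀.inf h₁) using 2 with x
    rw [hf k, Finset.piecewise_insert, Function.update_idem, Function.update_idem,
      Function.update_self, s.update_piecewise_of_notMem _ _ hk,
      s.update_piecewise_of_notMem _ _ hk]

/-- The median based decomposition formula characterizes w.l.p. functions:
`f` satisfies `f x = median (f_k^0 x) (x k) (f_k^1 x)` for all `k` and `x`
(where `f_k^0`, `f_k^1` fix the `k`-th variable at `0`, `1`, and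
`median a b c = (a ⊓ b) ⊔ (b ⊓ c) ⊔ (a ⊓ c)`) iff `f` is a w.l.p. function. -/
theorem median_decomposition_iff_wlp
    {L : Type*} [DistribLattice L] [BoundedOrder L] {n : ℕ} (hn : 1 ≤ n)
    (f : (Fin n → L) → L) :
    (∀ (k : Fin n) (x : Fin n → L),
        f x = (f (Function.update x k ⊥) ⊓ x k) ⊔
              (x k ⊓ f (Function.update x k ⊤)) ⊔
              (f (Function.update x k ⊥) ⊓ f (Function.update x k ⊤))) ↔
      IsWLP f := by
  refine ⟨fun h => ?_, fun hf k x => ?_⟩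
  · simpa using isWLP_piecewise_of_median h Finset.univ ⊥
  · rw [median_eq_of_le _ (hf.monotone_s18 (Function.update_mono bot_le))]
    exact hf.eq_sup_inf_update k x
end
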